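/- For every k ≥ 2 and sufficiently large n: (k−1−o(1))·ex(n,C_4) ≤ f_k(n,C_4) ≤ (k−1)·ex(n,C_4). -/

import Mathlib

open Function Filter Asymptotics

/-- `Copies H G`: `G` contains a copy of `H` (an injective graph homomorphism). -/
def Copies {α β : Type*} (H : SimpleGraph α) (G : SimpleGraph β) : Prop :=
  ∃ f : α → β, Injective f ∧ ∀ ⦃u v⦄, H.Adj u v → G.Adj (f u) (f v)

/-- Turán number: max number of edges of an `n`-vertex `H`-free graph. -/
noncomputable def exNum {α : Type*} (n : ℕ) (H : SimpleGraph α) : ℕ :=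
  sSup {m | ∃ G : SimpleGraph (Fin n), ¬ Copies H G ∧ m = Nat.card G.edgeSet}

/-- NIM-H edges of a `k`-edge-coloring `c` of `K_n`: nondiagonal pairs lying in no
monochromatic copy of `H`. -/
def NIMedges {α : Type*} {n k : ℕ} (H : SimpleGraph α) (c : Sym2 (Fin n) → Fin k) :
    Set (Sym2 (Fin n)) :=
  {e | ¬ e.IsDiag ∧ ∀ (i : Fin k) (f : α → Fin n), Injective f →
      (∀ ⦃u v⦄, H.Adj u v → c s(f u, f v) = i) →
      ∀ ⦃u v⦄, H.Adj u v → e ≠ s(f u, f v)}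

/-- `fNum n k H`: maximum number of NIM-H edges over all `k`-edge-colorings of `K_n`. -/
noncomputable def fNum {α : Type*} (n k : ℕ) (H : SimpleGraph α) : ℕ :=
  sSup {m | ∃ c : Sym2 (Fin n) → Fin k, m = Nat.card (NIMedges H c)}


open Classical in
/-- number of ordered pairs in a relation -/
noncomputable def pc {V : Type*} [Fintype V] (R : V → V → Prop) : ℕ :=
  (Finset.univ.filter fun p : V × V => R p.1 p.2).card

/-- C4-freeness, by common neighbours -/
def CF {V : Type*} (G : SimpleGraph V) : Prop :=
  ∀ a b x y, a ≠ b → G.Adj a x → G.Adj b x → G.Adj a y → G.Adj b y → x = y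

lemma cyc4_adj : ∀ u v : Fin 4, (SimpleGraph.cycleGraph 4).Adj u v ↔
    (v = u + 1 ∨ u = v + 1) := by
  decide

lemma cf_iff {V : Type*} (G : SimpleGraph V) :
    CF G ↔ ¬ Copies (SimpleGraph.cycleGraph 4) G := by
  constructor
  · rintro h ⟨f, hf, hadj⟩
    have h01 : G.Adj (f 0) (f 1) := hadj (by decide)
    have h21 : G.Adj (f 2) (f 1) := hadj (by decide)
    have h03 : G.Adj (f 0) (f 3) := hadj (by decide)
    have h23 : G.Adj (f 2) (f 3) := hadj (by decide)
    have := h _ _ _ _ (fun e => by have := hf e; revert this; decide) h01 h21 h03 h23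
    have := hf this
    revert this; decide
  · intro h a b x y hab h1 h2 h3 h4
    by_contra hxy
    apply h
    refine ⟨![a, x, b, y], ?_, ?_⟩
    · have e1 := h1.ne
      have e2 := h2.ne
      have e3 := h3.ne
      have e4 := h4.ne
      intro u v huv
      fin_cases u <;> fin_cases v <;> simp at huv ⊢ <;> first | exact huv.elim | grind
    · intro u v huv
      rw [cyc4_adj] at huv
      have := h1.symm
      have := h2.symm
      have := h3.symm
      have := h4.symm
      fin_cases u <;> fin_cases v <;> simp at huv ⊢ <;> assumption

section pcl
variable {V : Type*} [Fintype V]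

lemma pc_mono {R S : V → V → Prop} (h : ∀ x y, R x y → S x y) : pc R ≤ pc S := by
  classical
  unfold pc
  apply Finset.card_le_card
  intro p hp
  simp only [Finset.mem_filter, Finset.mem_univ, true_and] at hp ⊢
  exact h _ _ hp

lemma pc_or (R S : V → V → Prop) : pc (fun x y => R x y ∨ S x y) ≤ pc R + pc S := by
  classical
  unfold pc
  refine le_trans (Finset.card_le_card ?_) (Finset.card_union_le _ _)
  intro p hp
  simpa using hp

lemma pc_or_disj (R S : V → V → Prop) (h : ∀ x y, R x y → S x y → False) :
    pc (fun x y => R x y ∨ S x y) = pc R + pc S := by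
  classical
  unfold pc
  rw [← Finset.card_union_of_disjoint]
  · congr 1
    ext p
    simp
  · rw [Finset.disjoint_left]
    intro p hp hq
    simp only [Finset.mem_filter, Finset.mem_univ, true_and] at hp hq
    exact h _ _ hp hq

lemma pc_swap (R : V → V → Prop) : pc (fun x y => R y x) = pc R := by
  classical
  unfold pc
  apply Finset.card_bij (fun p _ => (p.2, p.1))
  · intro p hp
    simpa using hp
  · rintro ⟨a, b⟩ _ ⟨c, d⟩ _ h
    simp at h ⊢
    tauto
  · rintro ⟨a, b⟩ h
    exact ⟨(b, a), by simpa using h, rfl⟩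

lemma pc_sum {ι : Type*} (s : Finset ι) (R : V → V → Prop) (S : ι → V → V → Prop)
    (h : ∀ x y, R x y → ∃ i ∈ s, S i x y) : pc R ≤ ∑ i ∈ s, pc (S i) := by
  classical
  unfold pc
  refine le_trans (Finset.card_le_card ?_) Finset.card_biUnion_le
  intro p hp
  simp only [Finset.mem_filter, Finset.mem_univ, true_and, Finset.mem_biUnion] at hp ⊢
  exact h _ _ hp

open Classical in
lemma pc_eq_sum (R : V → V → Prop) :
    pc R = ∑ x, (Finset.univ.filter fun y => R x y).card := by
  unfold pc
  rw [Finset.card_eq_sum_card_fiberwise (f := Prod.fst) (t := Finset.univ) (by simp)]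
  apply Finset.sum_congr rfl
  intro x _
  symm
  apply Finset.card_bij (fun y _ => (x, y))
  · intro y hy
    simpa using hy
  · intro y _ z _ h
    simpa using h
  · rintro ⟨a, b⟩ h
    simp at h
    exact ⟨b, by simpa [← h.2] using h.1, by simp [h.2]⟩

open Classical in
lemma pc_eq_sum' (R : V → V → Prop) :
    pc R = ∑ y, (Finset.univ.filter fun x => R x y).card := by
  rw [← pc_swap, pc_eq_sum]

lemma pc_edges (G : SimpleGraph V) : pc G.Adj = 2 * Nat.card G.edgeSet := by
  classical
  rw [Nat.card_eq_fintype_card, ← SimpleGraph.edgeFinset_card, SimpleGraph.two_mul_card_edgeFinset]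
  rfl

lemma pc_map {W : Type*} [Fintype W] (G : SimpleGraph V) (f : V ↪ W) :
    pc (G.map f).Adj = pc G.Adj := by
  classical
  unfold pc
  symm
  apply Finset.card_bij (fun p _ => (f p.1, f p.2))
  · intro p hp
    simp at hp ⊢
    exact hp
  · rintro ⟨a, b⟩ _ ⟨c, d⟩ _ h
    simpa using h
  · rintro ⟨a, b⟩ h
    simp [SimpleGraph.map_adj] at h
    obtain ⟨u, v, h1, rfl, rfl⟩ := h
    exact ⟨(u, v), by simpa using h1, rfl⟩

end pcl

lemma CF.map {V W : Type*} {G : SimpleGraph V} (h : CF G) (f : V ↪ W) : CF (G.map f) := by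
  intro a b x y hab h1 h2 h3 h4
  rw [SimpleGraph.map_adj] at h1 h2 h3 h4
  obtain ⟨u1, v1, e1, rfl, rfl⟩ := h1
  obtain ⟨u2, v2, e2, rfl, g2⟩ := h2
  obtain ⟨u3, v3, e3, g3, rfl⟩ := h3
  obtain ⟨u4, v4, e4, g4, g5⟩ := h4
  have := f.injective g2
  have := f.injective g3
  have := f.injective g4
  have := f.injective g5
  subst_vars
  rw [h _ _ _ _ (fun e => hab (by rw [e])) e1 e2 e3 e4]

lemma CF.mono {V : Type*} {G H : SimpleGraph V} (h : CF G) (hle : H ≤ G) : CF H :=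
  fun a b x y hab h1 h2 h3 h4 => h a b x y hab (hle h1) (hle h2) (hle h3) (hle h4)

lemma ex_bdd (n : ℕ) : BddAbove {m | ∃ G : SimpleGraph (Fin n),
    ¬ Copies (SimpleGraph.cycleGraph 4) G ∧ m = Nat.card G.edgeSet} := by
  refine ⟨n * n, ?_⟩
  rintro m ⟨G, -, rfl⟩
  have h1 := pc_edges G
  have h2 : pc G.Adj ≤ n * n := by
    unfold pc
    refine le_trans (Finset.card_le_univ _) ?_
    simp
  omega

/-- shorthand for the Turan number -/
noncomputable abbrev ex4 (n : ℕ) : ℕ := exNum n (SimpleGraph.cycleGraph 4)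

lemma pc_le_ex {n : ℕ} {G : SimpleGraph (Fin n)} (h : CF G) : pc G.Adj ≤ 2 * ex4 n := by
  rw [pc_edges]
  have : Nat.card G.edgeSet ≤ ex4 n := le_csSup (ex_bdd n) ⟨G, (cf_iff G).1 h, rfl⟩
  omega

lemma exists_ex (n : ℕ) : ∃ G : SimpleGraph (Fin n), CF G ∧ pc G.Adj = 2 * ex4 n := by
  have hne : {m | ∃ G : SimpleGraph (Fin n),
    ¬ Copies (SimpleGraph.cycleGraph 4) G ∧ m = Nat.card G.edgeSet}.Nonempty := by
    refine ⟨_, ⊥, ?_, rfl⟩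
    rw [← cf_iff]
    intro a b x y hab h1
    exact absurd h1 (by simp)
  obtain ⟨G, hG, he⟩ := Nat.sSup_mem hne (ex_bdd n)
  refine ⟨G, (cf_iff G).2 hG, ?_⟩
  rw [pc_edges, ← he]
  rfl

lemma pc_le_ex' {V : Type*} [Fintype V] {n : ℕ} {G : SimpleGraph V} (h : CF G)
    (hV : Fintype.card V ≤ n) : pc G.Adj ≤ 2 * ex4 n := by
  obtain ⟨f⟩ : Nonempty (V ↪ Fin n) := by
    apply Function.Embedding.nonempty_of_card_le
    simpa using hV
  rw [← pc_map G f]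
  exact pc_le_ex (h.map f)

/-- two C4-free graphs on disjoint vertex sets -/
lemma CF.union {V : Type*} {G H : SimpleGraph V} (hG : CF G) (hH : CF H) (A : Set V)
    (h1 : ∀ x y, G.Adj x y → x ∈ A) (h2 : ∀ x y, H.Adj x y → x ∉ A) : CF (G ⊔ H) := by
  intro a b x y hab e1 e2 e3 e4
  have h1' : ∀ x y, G.Adj x y → y ∈ A := fun x y h => h1 _ _ h.symm
  have h2' : ∀ x y, H.Adj x y → y ∉ A := fun x y h => h2 _ _ h.symm
  simp only [SimpleGraph.sup_adj] at e1 e2 e3 e4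
  by_cases ha : a ∈ A
  · have e1 : G.Adj a x := by rcases e1 with e | e; exacts [e, absurd ha (h2 _ _ e)]
    have e3 : G.Adj a y := by rcases e3 with e | e; exacts [e, absurd ha (h2 _ _ e)]
    have e2 : G.Adj b x := by
      rcases e2 with e | e; exacts [e, absurd (h1' _ _ e1) (h2' _ _ e)]
    have e4 : G.Adj b y := by
      rcases e4 with e | e; exacts [e, absurd (h1' _ _ e3) (h2' _ _ e)]
    exact hG _ _ _ _ hab e1 e2 e3 e4
  · have e1 : H.Adj a x := by rcases e1 with e | e; exacts [absurd (h1 _ _ e) ha, e]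
    have e3 : H.Adj a y := by rcases e3 with e | e; exacts [absurd (h1 _ _ e) ha, e]
    have e2 : H.Adj b x := by
      rcases e2 with e | e; exacts [absurd (h1' _ _ e) (h2' _ _ e1), e]
    have e4 : H.Adj b y := by
      rcases e4 with e | e; exacts [absurd (h1' _ _ e) (h2' _ _ e3), e]
    exact hH _ _ _ _ hab e1 e2 e3 e4

lemma ex_gap {n : ℕ} {G : SimpleGraph (Fin n)} (h : CF G) (W : Finset (Fin n))
    (hW : ∀ x y, G.Adj x y → x ∉ W) : pc G.Adj + 2 * ex4 W.card ≤ 2 * ex4 n := by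
  obtain ⟨E, hE, hq⟩ := exists_ex W.card
  let f : Fin W.card ↪ Fin n := (W.equivFin.symm.toEmbedding).trans (Function.Embedding.subtype _)
  have hf : ∀ i, f i ∈ W := fun i => (W.equivFin.symm i).2
  have hEW : ∀ x y, (E.map f).Adj x y → x ∈ W := by
    intro x y hxy
    rw [SimpleGraph.map_adj] at hxy
    obtain ⟨u, v, -, rfl, -⟩ := hxy
    exact hf u
  have hc : CF (E.map f ⊔ G) := (hE.map f).union h (W : Set (Fin n)) hEW hW
  have := pc_le_ex hc
  rw [← hq, ← pc_map E f]
  refine le_trans (le_of_eq ?_) this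
  rw [add_comm, ← pc_or_disj]
  · rfl
  · intro x y h1 h2
    exact hW _ _ h2 (hEW _ _ h1)

/-- Kovari-Sos-Turan type bound -/
lemma kst {n : ℕ} {G : SimpleGraph (Fin n)} (h : CF G) (Z : Finset (Fin n)) :
    (pc (fun x y => x ∈ Z ∧ G.Adj x y) : ℝ) ≤ n + Real.sqrt n * Z.card := by
  classical
  set d : Fin n → ℕ := fun y => (Finset.univ.filter fun x => x ∈ Z ∧ G.Adj x y).card with hd
  have hS : pc (fun x y => x ∈ Z ∧ G.Adj x y) = ∑ y, d y := by
    rw [pc_eq_sum']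
    simp only [hd]
    congr!
  have h2 : ∑ y, d y * d y ≤ Z.card * Z.card + ∑ y, d y := by
    have e1 : ∀ y, d y * d y = d y + ((Z ×ˢ Z).filter fun p =>
        p.1 ≠ p.2 ∧ G.Adj p.1 y ∧ G.Adj p.2 y).card := by
      intro y
      have := Finset.offDiag_card (s := (Finset.univ.filter fun x => x ∈ Z ∧ G.Adj x y))
      have h3 : (Finset.univ.filter fun x => x ∈ Z ∧ G.Adj x y).offDiag =
        ((Z ×ˢ Z).filter fun p => p.1 ≠ p.2 ∧ G.Adj p.1 y ∧ G.Adj p.2 y) := by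
        ext ⟨a, b⟩
        simp
        tauto
      rw [← h3, this]
      have : d y ≤ d y * d y := Nat.le_mul_self _
      simp only [hd] at this ⊢
      omega
    rw [Finset.sum_congr rfl (fun y _ => e1 y), Finset.sum_add_distrib, add_comm]
    gcongr
    rw [← Finset.card_product]
    have : ∀ y, ((Z ×ˢ Z).filter fun p => p.1 ≠ p.2 ∧ G.Adj p.1 y ∧ G.Adj p.2 y).card =
      ∑ p ∈ Z ×ˢ Z, if p.1 ≠ p.2 ∧ G.Adj p.1 y ∧ G.Adj p.2 y then 1 else 0 := by
      intro y
      rw [Finset.card_filter]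
    rw [Finset.sum_congr rfl (fun y _ => this y), Finset.sum_comm, Finset.card_eq_sum_ones]
    apply Finset.sum_le_sum
    rintro ⟨a, b⟩ _
    rw [← Finset.card_filter, Finset.card_le_one]
    intro x hx y hy
    simp at hx hy
    exact h a b x y hx.1 hx.2.1 hx.2.2 hy.2.1 hy.2.2
  have h3 : (∑ y, d y) ^ 2 ≤ n * ∑ y, d y ^ 2 := by
    simpa using sq_sum_le_card_mul_sum_sq (s := (Finset.univ : Finset (Fin n))) (f := d)
  rw [hS]
  set S := ∑ y, d y with hSS
  have h4 : S ^ 2 ≤ n * (Z.card * Z.card + S) := by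
    refine h3.trans (Nat.mul_le_mul_left _ ?_)
    simpa [sq] using h2
  have h5 : (S : ℝ) ^ 2 ≤ n * (Z.card * Z.card + S) := by exact_mod_cast h4
  by_contra hcon
  push Not at hcon
  have hn : (0 : ℝ) ≤ n := Nat.cast_nonneg n
  have hz : (0 : ℝ) ≤ Real.sqrt n * Z.card := by positivity
  have hsq := Real.sq_sqrt hn
  have : (Real.sqrt n * Z.card) * (Real.sqrt n * Z.card) < S * (S - n) := by
    nlinarith
  nlinarith

/-- point-line incidence graph of an affine plane without vertical lines -/
def incG (p : ℕ) : SimpleGraph ((ZMod p × ZMod p) ⊕ (ZMod p × ZMod p)) :=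
  SimpleGraph.fromRel (fun a b => ∃ x m t : ZMod p, a = Sum.inl (x, m * x + t) ∧ b = Sum.inr (m, t))

lemma incG_cf (p : ℕ) [Fact p.Prime] : CF (incG p) := by
  have key : ∀ x y x' y' m t m' t' : ZMod p, y = m * x + t → y' = m * x' + t →
      y = m' * x + t' → y' = m' * x' + t' → (x = x' ∧ y = y') ∨ (m = m' ∧ t = t') := by
    intro x y x' y' m t m' t' h1 h2 h3 h4
    have : (m - m') * (x - x') = 0 := by linear_combination h3 - h1 - h4 + h2
    rcases mul_eq_zero.1 this with h | h
    · right
      have hm : m = m' := sub_eq_zero.1 h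
      subst hm
      exact ⟨rfl, by linear_combination h3 - h1⟩
    · left
      have hm : x = x' := sub_eq_zero.1 h
      subst hm
      exact ⟨rfl, by linear_combination h1 - h2⟩
  have adj : ∀ x y m t, (incG p).Adj (Sum.inl (x, y)) (Sum.inr (m, t)) ↔ y = m * x + t := by
    intro x y m t
    simp [incG, SimpleGraph.fromRel_adj]
  have adj' : ∀ x y m t, (incG p).Adj (Sum.inr (m, t)) (Sum.inl (x, y)) ↔ y = m * x + t := by
    intro x y m t
    rw [SimpleGraph.adj_comm, adj]
  have adj1 : ∀ a b, ¬ (incG p).Adj (Sum.inl a) (Sum.inl b) := by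
    intro a b
    simp [incG, SimpleGraph.fromRel_adj]
  have adj2 : ∀ a b, ¬ (incG p).Adj (Sum.inr a) (Sum.inr b) := by
    intro a b
    simp [incG, SimpleGraph.fromRel_adj]
  rintro (⟨a1, a2⟩ | ⟨a1, a2⟩) (⟨b1, b2⟩ | ⟨b1, b2⟩) (⟨x1, x2⟩ | ⟨x1, x2⟩) (⟨y1, y2⟩ | ⟨y1, y2⟩) hab h1 h2 h3 h4 <;>
    simp only [adj, adj', adj1, adj2] at h1 h2 h3 h4
  · rcases key _ _ _ _ _ _ _ _ h1 h2 h3 h4 with h | h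
    · exact absurd (by rw [h.1, h.2]) hab
    · rw [h.1, h.2]
  · rcases key _ _ _ _ _ _ _ _ h1 h3 h2 h4 with h | h
    · rw [h.1, h.2]
    · exact absurd (by rw [h.1, h.2]) hab

lemma incG_pc (p : ℕ) [Fact p.Prime] : p ^ 3 ≤ pc (incG p).Adj := by
  classical
  unfold pc
  have : (Finset.univ : Finset (ZMod p × ZMod p × ZMod p)).card = p ^ 3 := by
    simp [ZMod.card]
    ring
  rw [← this]
  apply Finset.card_le_card_of_injOn
    (fun q => (Sum.inl (q.1, q.2.1 * q.1 + q.2.2), Sum.inr (q.2.1, q.2.2)))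
  · intro q _
    simp [incG, SimpleGraph.fromRel_adj]
    exact ⟨_, _, rfl, rfl⟩
  · rintro ⟨a, b, c⟩ _ ⟨d, e, f⟩ _ h
    simp at h ⊢
    tauto

lemma ex_lower {n : ℕ} (hn : 8 ≤ n) :
    ((n : ℝ) / 8) * Real.sqrt ((n : ℝ) / 8) ≤ 2 * (ex4 n : ℝ) := by
  set t := Nat.sqrt (n / 8) with ht
  have ht0 : t ≠ 0 := by
    have : 1 ≤ Nat.sqrt (n / 8) := by
      rw [Nat.le_sqrt]
      omega
    omega
  obtain ⟨p, hp, h1, h2⟩ := Nat.exists_prime_lt_and_le_two_mul t ht0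
  have : Fact p.Prime := ⟨hp⟩
  have ht2 : t * t ≤ n / 8 := Nat.sqrt_le _
  have ht3 : n / 8 < (t + 1) * (t + 1) := Nat.lt_succ_sqrt _
  have hpc : n / 8 < p * p := lt_of_lt_of_le ht3 (Nat.mul_le_mul h1 h1)
  have hn8 : n ≤ 8 * (p * p) := by omega
  have hcard : p * p + p * p ≤ n := by
    have : p * p ≤ (2 * t) * (2 * t) := Nat.mul_le_mul h2 h2
    have e : (2 * t) * (2 * t) = 4 * (t * t) := by ring
    omega
  have h5 := (incG_pc p).trans (pc_le_ex' (n := n) (incG_cf p) (by simpa [ZMod.card] using hcard))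
  have h6 : ((p : ℝ)) ^ 3 ≤ 2 * (ex4 n : ℝ) := by exact_mod_cast h5
  refine le_trans ?_ h6
  have h7 : (n : ℝ) / 8 ≤ (p : ℝ) ^ 2 := by
    have : (n : ℝ) ≤ 8 * (p * p) := by exact_mod_cast hn8
    linarith [sq (p : ℝ)]
  have h8 : Real.sqrt ((n : ℝ) / 8) ≤ p := Real.sqrt_le_iff.2 ⟨by positivity, h7⟩
  calc ((n : ℝ) / 8) * Real.sqrt ((n : ℝ) / 8) ≤ (p : ℝ) ^ 2 * p := by gcongr
    _ = (p : ℝ) ^ 3 := by ring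

/-- abstract setting: colouring together with NIM graphs -/
structure Setup (n k : ℕ) where
  col : Fin n → Fin n → Fin k
  sym : ∀ x y, col x y = col y x
  N : Fin k → SimpleGraph (Fin n)
  hN : ∀ i u v, (N i).Adj u v → col u v = i
  path : ∀ i u v x y, (N i).Adj u v → x ≠ u → y ≠ x → y ≠ v → x ≠ v → y ≠ u →
    col u x = i → col x y = i → col y v = i → False

namespace Setup
variable {n k : ℕ} (S : Setup n k)

def D (i : Fin k) (w : Fin n) : Finset (Fin n) := Finset.univ.filter (fun x => x ≠ w ∧ S.col w x = i)

lemma mem_D {i w x} : x ∈ S.D i w ↔ x ≠ w ∧ S.col w x = i := by simp [D]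

lemma D_comm {i w x} : x ∈ S.D i w ↔ w ∈ S.D i x := by
  rw [mem_D, mem_D, S.sym, ne_comm]

lemma cf (i : Fin k) : CF (S.N i) := by
  intro a b x y hab h1 h2 h3 h4
  by_contra hxy
  exact S.path i a x y b h1 h3.ne.symm h4.ne h2.ne (Ne.symm hxy) (Ne.symm hab)
    (S.hN _ _ _ h3) (S.hN _ _ _ h4.symm) (S.hN _ _ _ h2)

lemma touchD (i : Fin k) (w : Fin n) : pc (fun x y => x ∈ S.D i w ∧ (S.N i).Adj x y) ≤ 2 * n := by
  classical
  rw [pc_eq_sum']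
  have : ∀ y, (Finset.univ.filter fun x => x ∈ S.D i w ∧ (S.N i).Adj x y).card ≤
      1 + if y = w then n else 0 := by
    intro y
    split_ifs with h
    · refine le_trans (Finset.card_le_univ _) ?_
      simp
    · rw [add_zero, Finset.card_le_one]
      intro a ha b hb
      simp only [Finset.mem_filter, Finset.mem_univ, true_and] at ha hb
      by_contra hab
      have ha' := S.mem_D.1 ha.1
      have hb' := S.mem_D.1 hb.1
      exact S.path i a y w b ha.2 ha'.1.symm hb'.1 hb.2.ne (Ne.symm h) (Ne.symm hab)
        ((S.sym _ _).trans ha'.2) hb'.2 (S.hN _ _ _ hb.2)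
  have h2 := Finset.sum_le_sum (s := Finset.univ) (fun y _ => this y)
  rw [Finset.sum_add_distrib] at h2
  simp at h2
  refine le_trans (le_of_eq ?_) (h2.trans (by omega))
  congr!

open Classical in
noncomputable def L (r : ℝ) (x : Fin n) : Finset (Fin k) :=
  Finset.univ.filter (fun l => r ≤ ((S.D l x).card : ℝ))

lemma mem_L {r x l} : l ∈ S.L r x ↔ r ≤ ((S.D l x).card : ℝ) := by simp [L]

lemma touchT (r : ℝ) (i : Fin k) :
    r * (pc (fun x y => i ∈ S.L r x ∧ (S.N i).Adj x y) : ℝ) ≤ 2 * n * n := by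
  classical
  set a : Fin n → ℕ := fun x => (Finset.univ.filter fun y => (S.N i).Adj x y).card with ha
  have h1 : ∑ x, (S.D i x).card * a x ≤ 2 * n * n := by
    have e1 : ∀ w, ∑ x, (if x ∈ S.D i w then a x else 0) ≤ 2 * n := by
      intro w
      refine le_trans (le_of_eq ?_) (S.touchD i w)
      rw [pc_eq_sum]
      apply Finset.sum_congr rfl
      intro x _
      split_ifs with h
      · simp only [ha, h, true_and]
      · simp [h]
    have e2 : ∀ x, (S.D i x).card * a x = ∑ w, (if x ∈ S.D i w then a x else 0) := by
      intro x
      rw [← Finset.sum_filter, Finset.sum_const, smul_eq_mul]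
      congr 2
      ext w
      simp [S.D_comm (w := w)]
    rw [Finset.sum_congr rfl (fun x _ => e2 x), Finset.sum_comm]
    refine (Finset.sum_le_sum (fun w _ => e1 w)).trans (le_of_eq ?_)
    simp
    ring
  have h2 : (∑ x, ((S.D i x).card : ℝ) * a x) ≤ 2 * n * n := by exact_mod_cast h1
  refine le_trans ?_ h2
  rw [pc_eq_sum]
  push_cast
  rw [Finset.mul_sum]
  apply Finset.sum_le_sum
  intro x _
  by_cases h : i ∈ S.L r x
  · have := S.mem_L.1 h
    have e : (Finset.univ.filter fun y => i ∈ S.L r x ∧ (S.N i).Adj x y).card = a x := by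
      simp only [ha, h, true_and]
    have e' : ((Finset.univ.filter fun y => i ∈ S.L r x ∧ (S.N i).Adj x y).card : ℝ) = a x := by
      exact_mod_cast e
    calc _ = r * (a x : ℝ) := by rw [← e']; congr!
      _ ≤ _ := by gcongr
  · simp [h]
    positivity

lemma sum_D (x : Fin n) : ∑ l, (S.D l x).card + 1 = n := by
  classical
  have h := Finset.card_eq_sum_card_fiberwise (s := Finset.univ.erase x) (f := S.col x)
    (t := Finset.univ) (by simp)
  have h2 : ∀ l, ((Finset.univ.erase x).filter (fun y => S.col x y = l)) = S.D l x := by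
    intro l
    ext y
    simp [mem_D]
  simp only [h2] at h
  rw [← h]
  have := x.pos
  simp
  omega

lemma cross {r : ℝ} (hr : 0 ≤ r) (A B : Finset (Fin n)) (hA : ∀ x ∈ A, ∀ y ∈ B, x ≠ y)
    (h : ∀ x ∈ A, ∀ y ∈ B, ∀ l, l ∈ S.L r x → l ∉ S.L r y) :
    (A.card : ℝ) * B.card ≤ k * r * (A.card + B.card) := by
  classical
  set E : Fin n → Finset (Fin n) := fun x =>
    (Finset.univ.filter (fun l => l ∉ S.L r x)).biUnion (fun l => S.D l x) with hE
  have hEc : ∀ x, ((E x).card : ℝ) ≤ k * r := by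
    intro x
    have h1 : (E x).card ≤ ∑ l ∈ Finset.univ.filter (fun l => l ∉ S.L r x), (S.D l x).card :=
      Finset.card_biUnion_le
    have h2 : ((E x).card : ℝ) ≤
        ∑ l ∈ Finset.univ.filter (fun l => l ∉ S.L r x), ((S.D l x).card : ℝ) := by
      exact_mod_cast h1
    refine h2.trans ?_
    have h3 : ∑ l ∈ Finset.univ.filter (fun l => l ∉ S.L r x), ((S.D l x).card : ℝ) ≤
        ∑ l ∈ Finset.univ.filter (fun l => l ∉ S.L r x), r := by
      apply Finset.sum_le_sum
      intro l hl
      simp only [Finset.mem_filter, Finset.mem_univ, true_and, mem_L, not_le] at hl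
      exact hl.le
    refine h3.trans ?_
    rw [Finset.sum_const, nsmul_eq_mul]
    have : (Finset.univ.filter (fun l => l ∉ S.L r x)).card ≤ k := by
      refine (Finset.card_le_univ _).trans ?_
      simp
    gcongr
  have h1 : A.card * B.card ≤ ∑ x ∈ A, (E x).card + ∑ y ∈ B, (E y).card := by
    have e0 : A.card * B.card = ∑ x ∈ A, ∑ y ∈ B, 1 := by simp
    have e1 : ∑ x ∈ A, ∑ y ∈ B, 1 ≤
        ∑ x ∈ A, ∑ y ∈ B, ((if y ∈ E x then 1 else 0) + (if x ∈ E y then 1 else 0)) := by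
      apply Finset.sum_le_sum
      intro x hx
      apply Finset.sum_le_sum
      intro y hy
      by_cases hl : S.col x y ∈ S.L r x
      · have h3 := h x hx y hy _ hl
        have : x ∈ E y := by
          simp only [hE, Finset.mem_biUnion, Finset.mem_filter, Finset.mem_univ, true_and]
          exact ⟨_, h3, S.mem_D.2 ⟨hA x hx y hy, S.sym _ _⟩⟩
        simp [this]
      · have : y ∈ E x := by
          simp only [hE, Finset.mem_biUnion, Finset.mem_filter, Finset.mem_univ, true_and]
          exact ⟨_, hl, S.mem_D.2 ⟨(hA x hx y hy).symm, rfl⟩⟩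
        simp [this]
    rw [e0]
    refine e1.trans ?_
    simp only [Finset.sum_add_distrib]
    gcongr with x hx
    · rw [← Finset.card_filter]
      apply Finset.card_le_card
      intro y hy
      exact (Finset.mem_filter.1 hy).2
    · rw [Finset.sum_comm]
      gcongr with y hy
      rw [← Finset.card_filter]
      apply Finset.card_le_card
      intro y hy
      exact (Finset.mem_filter.1 hy).2
  have h2 : (A.card : ℝ) * B.card ≤ ∑ x ∈ A, ((E x).card : ℝ) + ∑ y ∈ B, ((E y).card : ℝ) := by
    exact_mod_cast h1
  refine h2.trans ?_
  have h3 := Finset.sum_le_sum (s := A) (fun x _ => hEc x)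
  have h4 := Finset.sum_le_sum (s := B) (fun x _ => hEc x)
  simp only [Finset.sum_const, nsmul_eq_mul] at h3 h4
  linarith

/-- restriction of a graph to vertices satisfying a predicate -/
def rg {V : Type*} (G : SimpleGraph V) (A : V → Prop) : SimpleGraph V where
  Adj x y := G.Adj x y ∧ A x ∧ A y
  symm := ⟨fun _ _ h => ⟨h.1.symm, h.2.2, h.2.1⟩⟩
  loopless := ⟨fun _ h => h.1.ne rfl⟩

lemma rg_le {V : Type*} (G : SimpleGraph V) (A : V → Prop) : rg G A ≤ G := fun _ _ h => h.1

lemma pc_touch {V : Type*} [Fintype V] (G : SimpleGraph V) (B : V → Prop) :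
    pc G.Adj ≤ pc (rg G (fun x => ¬ B x)).Adj + 2 * pc (fun x y => B x ∧ G.Adj x y) := by
  have h1 : pc G.Adj ≤ pc (fun x y => (rg G (fun x => ¬ B x)).Adj x y ∨
      ((B x ∧ G.Adj x y) ∨ (B y ∧ G.Adj y x))) := by
    apply pc_mono
    intro x y h
    by_cases hx : B x
    · exact Or.inr (Or.inl ⟨hx, h⟩)
    · by_cases hy : B y
      · exact Or.inr (Or.inr ⟨hy, h.symm⟩)
      · exact Or.inl ⟨h, hx, hy⟩
  have h2 := pc_or (rg G (fun x => ¬ B x)).Adj (fun x y => (B x ∧ G.Adj x y) ∨ (B y ∧ G.Adj y x))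
  have h3 := pc_or (fun x y => B x ∧ G.Adj x y) (fun x y => B y ∧ G.Adj y x)
  have h4 := pc_swap (fun x y => B x ∧ G.Adj x y)
  omega

/-- contribution of one colour `j` -/
lemma piece (r : ℝ) (c j : Fin k) (W : Finset (Fin n)) (hW : ∀ x ∈ W, c ∈ S.L r x) :
    pc (S.N j).Adj + pc (rg (S.N c) (fun x => j ∈ S.L r x ∧ c ∉ S.L r x)).Adj + 2 * ex4 W.card ≤
      2 * ex4 n + 2 * pc (fun x y => j ∈ S.L r x ∧ (S.N j).Adj x y) +
        2 * pc (fun x y => x ∈ W ∧ (S.N j).Adj x y) := by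
  set G1 := rg (S.N j) (fun x => ¬ (j ∈ S.L r x ∨ x ∈ W)) with hG1
  set G2 := rg (S.N c) (fun x => j ∈ S.L r x ∧ c ∉ S.L r x) with hG2
  have h1 : pc (S.N j).Adj ≤ pc G1.Adj +
      2 * pc (fun x y => (j ∈ S.L r x ∨ x ∈ W) ∧ (S.N j).Adj x y) :=
    pc_touch (S.N j) (fun x => j ∈ S.L r x ∨ x ∈ W)
  have h2 : pc (fun x y => (j ∈ S.L r x ∨ x ∈ W) ∧ (S.N j).Adj x y) ≤
      pc (fun x y => j ∈ S.L r x ∧ (S.N j).Adj x y) + pc (fun x y => x ∈ W ∧ (S.N j).Adj x y) := by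
    refine le_trans (pc_mono ?_) (pc_or _ _)
    intro x y h
    tauto
  have hcf : CF (G1 ⊔ G2) := by
    apply CF.union ((S.cf j).mono (rg_le _ _)) ((S.cf c).mono (rg_le _ _)) {x | j ∉ S.L r x}
    · intro x y h
      have := h.2.1
      simp only [Set.mem_ofPred_eq]
      tauto
    · intro x y h
      have := h.2.1
      simp only [Set.mem_ofPred_eq]
      tauto
  have h3 := ex_gap hcf W (by
    rintro x y (h | h) hx
    · exact h.2.1 (Or.inr hx)
    · exact h.2.1.2 (hW x hx))
  have h4 : pc (G1 ⊔ G2).Adj = pc G1.Adj + pc G2.Adj := by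
    rw [← pc_or_disj]
    · rfl
    · intro x y h h'
      exact h.2.1 (Or.inl h'.2.1.1)
  omega

/-- if all vertices have large degree in colour `c`, there are no NIM edges in colour `c` -/
lemma no_nim (hn : 8 ≤ n) (c : Fin k) (h : ∀ w, ∀ i ≠ c, 4 * k * (S.D i w).card < n) :
    pc (S.N c).Adj = 0 := by
  classical
  have hk : 0 < k := c.pos
  have hd : ∀ w, 3 * n ≤ 4 * (S.D c w).card + 4 := by
    intro w
    have h1 := S.sum_D w
    rw [← Finset.add_sum_erase _ _ (Finset.mem_univ c)] at h1
    have h2 : 4 * k * ∑ l ∈ Finset.univ.erase c, (S.D l w).card ≤ k * n := by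
      rw [Finset.mul_sum]
      calc _ ≤ ∑ l ∈ Finset.univ.erase c, n := by
            apply Finset.sum_le_sum
            intro l hl
            exact (h w l (Finset.ne_of_mem_erase hl)).le
        _ ≤ k * n := by
            rw [Finset.sum_const, smul_eq_mul]
            gcongr
            refine (Finset.card_le_univ _).trans ?_
            simp
    have h3 : 4 * ∑ l ∈ Finset.univ.erase c, (S.D l w).card ≤ n := by
      apply Nat.le_of_mul_le_mul_left _ hk
      rw [← mul_assoc, mul_comm k 4]
      exact h2
    omega
  unfold pc
  rw [Finset.card_eq_zero, Finset.filter_eq_empty_iff]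
  rintro ⟨u, v⟩ _ huv
  simp only at huv
  obtain ⟨x, hx⟩ : ((S.D c u).erase v).Nonempty := by
    rw [← Finset.card_pos]
    have := Finset.pred_card_le_card_erase (s := S.D c u) (a := v)
    have := hd u
    omega
  obtain ⟨y, hy⟩ : (((S.D c x) ∩ (S.D c v)).erase u).Nonempty := by
    rw [← Finset.card_pos]
    have := Finset.pred_card_le_card_erase (s := (S.D c x) ∩ (S.D c v)) (a := u)
    have h1 := hd x
    have h2 := hd v
    have h3 := Finset.card_union_add_card_inter (S.D c x) (S.D c v)
    have h4 : (S.D c x ∪ S.D c v).card ≤ n := by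
      refine (Finset.card_le_univ _).trans ?_
      simp
    omega
  simp only [Finset.mem_erase, Finset.mem_inter, mem_D] at hx hy
  exact S.path c u v x y huv hx.2.1 hy.2.1.1 hy.2.2.1 hx.1 hy.1 hx.2.2 hy.2.1.2
    ((S.sym _ _).trans hy.2.2.2)

end Setup

namespace Setup
variable {n k : ℕ} (S : Setup n k)

lemma L_nonempty {r : ℝ} (h : k * r < n - 1) (x : Fin n) :
    (S.L r x).Nonempty := by
  classical
  by_contra hne
  rw [Finset.not_nonempty_iff_eq_empty] at hne
  have h1 := S.sum_D x
  have h2 : (∑ l, ((S.D l x).card : ℝ)) + 1 = n := by exact_mod_cast h1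
  have h3 : (∑ l, ((S.D l x).card : ℝ)) ≤ ∑ l : Fin k, r := by
    apply Finset.sum_le_sum
    intro l _
    have : l ∉ S.L r x := by simp [hne]
    rw [mem_L, not_le] at this
    exact this.le
  simp at h3
  linarith

open Classical in
/-- vertices with the same type -/
noncomputable def fib (r : ℝ) (t : Finset (Fin k)) : Finset (Fin n) :=
  Finset.univ.filter (fun y => S.L r y = t)

lemma mem_fib {r t y} : y ∈ S.fib r t ↔ S.L r y = t := by simp [fib]

open Classical in
noncomputable def Z (r d : ℝ) : Finset (Fin n) :=
  Finset.univ.filter (fun x => ((S.fib r (S.L r x)).card : ℝ) < d)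

lemma mem_Z {r d x} : x ∈ S.Z r d ↔ ((S.fib r (S.L r x)).card : ℝ) < d := by simp [Z]

lemma card_Z (r d : ℝ) (hd : 0 ≤ d) : ((S.Z r d).card : ℝ) ≤ 2 ^ k * d := by
  classical
  have h := Finset.card_eq_sum_card_fiberwise (s := S.Z r d) (f := S.L r)
    (t := Finset.univ) (by simp)
  have h' : ((S.Z r d).card : ℝ) =
    ∑ t, (((S.Z r d).filter (fun x => S.L r x = t)).card : ℝ) := by exact_mod_cast h
  rw [h']
  have : ∀ t, (((S.Z r d).filter (fun x => S.L r x = t)).card : ℝ) ≤ d := by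
    intro t
    rcases ((S.Z r d).filter (fun x => S.L r x = t)).eq_empty_or_nonempty with h0 | ⟨x, hx⟩
    · rw [h0]; simpa using hd
    · rw [Finset.mem_filter, mem_Z] at hx
      refine le_trans ?_ hx.1.le
      rw [hx.2]
      gcongr
      intro y hy
      rw [Finset.mem_filter] at hy
      exact S.mem_fib.2 hy.2
  refine (Finset.sum_le_sum (fun t _ => this t)).trans (le_of_eq ?_)
  simp

lemma big_fib (r : ℝ) (hn : 0 < n) : ∃ x, n ≤ 2 ^ k * (S.fib r (S.L r x)).card := by
  classical
  by_contra hcon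
  push Not at hcon
  have h := Finset.card_eq_sum_card_fiberwise (s := (Finset.univ : Finset (Fin n))) (f := S.L r)
    (t := Finset.univ) (by simp)
  have h1 : 2 ^ k * n < 2 ^ k * n := by
    calc 2 ^ k * n = ∑ t : Finset (Fin k), 2 ^ k * (S.fib r t).card := by
          rw [← Finset.mul_sum]
          congr 1
          simp only [Finset.card_univ, Fintype.card_fin] at h
          convert h using 3
          ext y
          simp [mem_fib]
      _ < ∑ t : Finset (Fin k), n := by
          apply Finset.sum_lt_sum_of_nonempty ⟨∅, Finset.mem_univ _⟩
          intro t _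
          rcases (S.fib r t).eq_empty_or_nonempty with h0 | ⟨x, hx⟩
          · rw [h0]; simpa using hn
          · rw [mem_fib] at hx
            rw [← hx]
            exact hcon x
      _ = 2 ^ k * n := by simp
  exact lt_irrefl _ h1

lemma inter {r d : ℝ} (hr : 0 ≤ r) (h : k * r < n - 1) (hd : 2 * (k * r) < d)
    {x y : Fin n} (hx : x ∉ S.Z r d) (hy : y ∉ S.Z r d) : ∃ l, l ∈ S.L r x ∧ l ∈ S.L r y := by
  by_contra hcon
  push Not at hcon
  rw [mem_Z, not_lt] at hx hy
  have h1 := S.cross hr (S.fib r (S.L r x)) (S.fib r (S.L r y)) (by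
    intro a ha b hb hab
    subst hab
    rw [mem_fib] at ha hb
    obtain ⟨l, hl⟩ := S.L_nonempty h a
    exact hcon l (ha ▸ hl) (hb ▸ hl)) (by
    intro a ha b hb l hl
    rw [mem_fib] at ha hb
    rw [hb]
    rw [ha] at hl
    exact hcon l hl)
  set a : ℝ := ((S.fib r (S.L r x)).card : ℝ)
  set b : ℝ := ((S.fib r (S.L r y)).card : ℝ)
  have hkr : 0 ≤ k * r := by positivity
  nlinarith

lemma core {e : ℝ} (he : 0 < e) (hn : 8 ≤ n) (hk : 0 < k)
    (hes : 8 * k * 2 ^ k * (3 * k * e) ≤ 1) :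
    (∃ c, pc (S.N c).Adj = 0) ∨ ∃ m : ℕ, (n : ℝ) ≤ 8 * k * 2 ^ k * m ∧
      (∑ i, (pc (S.N i).Adj : ℝ)) + 2 * (ex4 m : ℝ) ≤ 2 * (k - 1) * (ex4 n : ℝ) +
        (k * (2 * (2 * n / e) + 2 * (n + Real.sqrt n * (2 ^ k * (3 * k * e * n)))) +
          2 * (2 * n / e + 2 * n)) := by
  classical
  have hk1 : (1 : ℝ) ≤ k := by exact_mod_cast hk
  have hn8 : (8 : ℝ) ≤ n := by exact_mod_cast hn
  have h2k : (1 : ℝ) ≤ 2 ^ k := one_le_pow₀ (by norm_num)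
  have hke : 0 < k * e := by positivity
  have hkes : 24 * (k * e) ≤ 1 := by
    have : k * e ≤ k * 2 ^ k * (k * e) := by
      have : 1 ≤ (k : ℝ) * 2 ^ k := by nlinarith
      nlinarith
    nlinarith
  set r : ℝ := e * n with hr
  set d : ℝ := 3 * k * e * n with hd
  have hr0 : 0 < r := by positivity
  have hkr : k * r < n - 1 := by
    rw [hr]; nlinarith
  have hdr : 2 * (k * r) < d := by
    rw [hr, hd]; nlinarith
  have hd0 : 0 ≤ d := by positivity
  have hZ := S.card_Z r d hd0
  have hZ' : 8 * k * (2 ^ k * d) ≤ n := by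
    rw [hd]; nlinarith
  have hint := fun {x y : Fin n} => S.inter (r := r) (d := d) (x := x) (y := y) hr0.le hkr hdr
  have heT : ∀ j, (pc (fun x y => j ∈ S.L r x ∧ (S.N j).Adj x y) : ℝ) ≤ 2 * n / e := by
    intro j
    have := S.touchT r j
    rw [le_div_iff₀ he]
    have hn0 : (0 : ℝ) < n := by linarith
    have h3 : n * ((pc (fun x y => j ∈ S.L r x ∧ (S.N j).Adj x y) : ℝ) * e) ≤ n * (2 * n) := by
      rw [hr] at this ⊢
      linarith
    exact le_of_mul_le_mul_left h3 hn0
  obtain ⟨x0, hx0⟩ := S.big_fib r (by omega : 0 < n)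
  have hx0Z : x0 ∉ S.Z r d := by
    rw [mem_Z, not_lt]
    have h1 : (n : ℝ) ≤ 2 ^ k * ((S.fib r (S.L r x0)).card : ℝ) := by exact_mod_cast hx0
    by_contra hcon
    push Not at hcon
    have : 2 ^ k * ((S.fib r (S.L r x0)).card : ℝ) < 2 ^ k * d := by gcongr
    nlinarith [show 0 ≤ 2 ^ k * d by positivity]
  obtain ⟨c, hc⟩ := S.L_nonempty hkr x0
  by_cases hB : ∀ w, ∀ i ≠ c, 4 * k * (S.D i w).card < n
  · exact Or.inl ⟨c, S.no_nim hn c hB⟩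
  right
  obtain ⟨i, hic, W, hWc, hWn, hWM⟩ : ∃ i ≠ c, ∃ W : Finset (Fin n), (∀ x ∈ W, c ∈ S.L r x) ∧
      (n : ℝ) ≤ 8 * k * 2 ^ k * W.card ∧
      (pc (fun x y => x ∈ W ∧ (S.N i).Adj x y) : ℝ) ≤ 2 * n / e + 2 * n := by
    have hn0 : (0 : ℝ) ≤ 2 * n := by linarith
    by_cases h2 : ∃ i ≠ c, i ∈ S.L r x0
    · obtain ⟨i, hic, hi⟩ := h2
      refine ⟨i, hic, S.fib r (S.L r x0), ?_, ?_, ?_⟩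
      · intro x hx
        rw [mem_fib] at hx
        rwa [hx]
      · have h1 : (n : ℝ) ≤ 2 ^ k * ((S.fib r (S.L r x0)).card : ℝ) := by exact_mod_cast hx0
        have : (0 : ℝ) ≤ 2 ^ k * ((S.fib r (S.L r x0)).card : ℝ) := by positivity
        nlinarith
      · have h1 : pc (fun x y => x ∈ S.fib r (S.L r x0) ∧ (S.N i).Adj x y) ≤
            pc (fun x y => i ∈ S.L r x ∧ (S.N i).Adj x y) := by
          apply pc_mono
          intro x y h
          have := S.mem_fib.1 h.1
          exact ⟨by rwa [this], h.2⟩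
        have h1' : (pc (fun x y => x ∈ S.fib r (S.L r x0) ∧ (S.N i).Adj x y) : ℝ) ≤
            pc (fun x y => i ∈ S.L r x ∧ (S.N i).Adj x y) := by exact_mod_cast h1
        linarith [heT i]
    · push Not at h2 hB
      obtain ⟨w, i, hic, hw⟩ := hB
      refine ⟨i, hic, S.D i w \ S.Z r d, ?_, ?_, ?_⟩
      · intro x hx
        rw [Finset.mem_sdiff] at hx
        obtain ⟨l, hl1, hl2⟩ := hint hx0Z hx.2
        by_cases hlc : l = c
        · rwa [← hlc]
        · exact absurd hl1 (h2 l hlc)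
      · have h1 : (n : ℝ) ≤ 4 * k * ((S.D i w).card : ℝ) := by exact_mod_cast hw
        have h3 : ((S.D i w).card : ℝ) ≤ ((S.D i w \ S.Z r d).card : ℝ) + ((S.Z r d).card : ℝ) := by
          have : (S.D i w).card ≤ (S.D i w \ S.Z r d).card + (S.Z r d).card :=
            Finset.card_le_card_sdiff_add_card
          exact_mod_cast this
        have h4 : 8 * k * ((S.Z r d).card : ℝ) ≤ n :=
          le_trans (by gcongr) hZ'
        have h5 : (n : ℝ) ≤ 8 * k * ((S.D i w \ S.Z r d).card : ℝ) := by
          nlinarith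
        have h6 : 0 ≤ 8 * k * ((S.D i w \ S.Z r d).card : ℝ) := by positivity
        nlinarith
      · have h1 : pc (fun x y => x ∈ S.D i w \ S.Z r d ∧ (S.N i).Adj x y) ≤
            pc (fun x y => x ∈ S.D i w ∧ (S.N i).Adj x y) := by
          apply pc_mono
          intro x y h
          exact ⟨(Finset.mem_sdiff.1 h.1).1, h.2⟩
        have h1' := h1.trans (S.touchD i w)
        have h1'' : (pc (fun x y => x ∈ S.D i w \ S.Z r d ∧ (S.N i).Adj x y) : ℝ) ≤ 2 * n := by
          exact_mod_cast h1'
        have : 0 ≤ 2 * n / e := by positivity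
        linarith
  refine ⟨W.card, hWn, ?_⟩
  set P : Fin k → ℕ := fun j => pc (rg (S.N c) (fun x => j ∈ S.L r x ∧ c ∉ S.L r x)).Adj with hP
  -- colour `c`
  have hcc : (pc (S.N c).Adj : ℝ) ≤ ∑ j ∈ Finset.univ.erase c, (P j : ℝ) +
      2 * (2 * n / e) + 2 * (n + Real.sqrt n * (2 ^ k * d)) := by
    have h1 := pc_touch (S.N c) (fun x => c ∈ S.L r x ∨ x ∈ S.Z r d)
    have h2 : pc (fun x y => (c ∈ S.L r x ∨ x ∈ S.Z r d) ∧ (S.N c).Adj x y) ≤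
        pc (fun x y => c ∈ S.L r x ∧ (S.N c).Adj x y) +
          pc (fun x y => x ∈ S.Z r d ∧ (S.N c).Adj x y) := by
      refine le_trans (pc_mono ?_) (pc_or _ _)
      intro x y h
      tauto
    have h3 : pc (rg (S.N c) (fun x => ¬ (c ∈ S.L r x ∨ x ∈ S.Z r d))).Adj ≤
        ∑ j ∈ Finset.univ.erase c, P j := by
      apply pc_sum
      intro x y h
      obtain ⟨h0, hx, hy⟩ := h
      push Not at hx hy
      obtain ⟨l, hl1, hl2⟩ := hint hx.2 hy.2
      refine ⟨l, ?_, h0, ⟨hl1, hx.1⟩, ⟨hl2, hy.1⟩⟩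
      rw [Finset.mem_erase]
      refine ⟨?_, Finset.mem_univ _⟩
      rintro rfl
      exact hx.1 hl1
    have h4 : pc (S.N c).Adj ≤ ∑ j ∈ Finset.univ.erase c, P j +
      2 * (pc (fun x y => c ∈ S.L r x ∧ (S.N c).Adj x y) +
          pc (fun x y => x ∈ S.Z r d ∧ (S.N c).Adj x y)) := by omega
    have h5 : (pc (S.N c).Adj : ℝ) ≤ ∑ j ∈ Finset.univ.erase c, (P j : ℝ) +
      2 * ((pc (fun x y => c ∈ S.L r x ∧ (S.N c).Adj x y) : ℝ) +
          (pc (fun x y => x ∈ S.Z r d ∧ (S.N c).Adj x y) : ℝ)) := by exact_mod_cast h4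
    have h6 := kst (S.cf c) (S.Z r d)
    have h7 : Real.sqrt n * (S.Z r d).card ≤ Real.sqrt n * (2 ^ k * d) := by gcongr
    linarith [heT c]
  -- other colours
  have hj : ∀ j ∈ Finset.univ.erase c, (pc (S.N j).Adj : ℝ) + P j +
      (if j = i then 2 * (ex4 W.card : ℝ) else 0) ≤
      2 * (ex4 n : ℝ) + 2 * (2 * n / e) + (if j = i then 2 * (2 * n / e + 2 * n) else 0) := by
    intro j _
    split_ifs with hji
    · subst hji
      have h1 := S.piece r c j W hWc
      have h2 : (pc (S.N j).Adj : ℝ) + P j + 2 * (ex4 W.card : ℝ) ≤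
        2 * (ex4 n : ℝ) + 2 * (pc (fun x y => j ∈ S.L r x ∧ (S.N j).Adj x y) : ℝ) +
        2 * (pc (fun x y => x ∈ W ∧ (S.N j).Adj x y) : ℝ) := by exact_mod_cast h1
      linarith [heT j]
    · have h1 := S.piece r c j ∅ (by simp)
      have h0 : pc (fun x y => x ∈ (∅ : Finset (Fin n)) ∧ (S.N j).Adj x y) = 0 := by
        simp [pc]
      have h2 : pc (S.N j).Adj + P j ≤
        2 * (ex4 n) + 2 * (pc (fun x y => j ∈ S.L r x ∧ (S.N j).Adj x y)) := by
        simp only [hP]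
        omega
      have h2' : (pc (S.N j).Adj : ℝ) + P j ≤
        2 * (ex4 n : ℝ) + 2 * (pc (fun x y => j ∈ S.L r x ∧ (S.N j).Adj x y) : ℝ) := by
        exact_mod_cast h2
      linarith [heT j]
  have hsum := Finset.sum_le_sum hj
  have hie : i ∈ Finset.univ.erase c := by simp [hic]
  simp only [Finset.sum_add_distrib, Finset.sum_const, Finset.sum_ite_eq', hie, if_true,
    nsmul_eq_mul] at hsum
  have hcard : ((Finset.univ.erase c : Finset (Fin k)).card : ℝ) = k - 1 := by
    rw [Finset.card_erase_of_mem (Finset.mem_univ _)]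
    simp
    rw [Nat.cast_sub hk]
    simp
  rw [hcard] at hsum
  rw [← Finset.add_sum_erase _ _ (Finset.mem_univ c)]
  have hE : 0 ≤ (n + Real.sqrt n * (2 ^ k * d)) := by positivity
  have hE2 : (n + Real.sqrt n * (2 ^ k * d)) ≤ k * (n + Real.sqrt n * (2 ^ k * d)) := by nlinarith
  linarith

end Setup

lemma setup_upper (k : ℕ) (hk : 2 ≤ k) : ∀ᶠ n : ℕ in atTop, ∀ S : Setup n k,
    (∑ i, (pc (S.N i).Adj : ℝ)) ≤ 2 * (k - 1) * (ex4 n : ℝ) := by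
  have hk1 : (1 : ℝ) ≤ k := by exact_mod_cast (by omega : 1 ≤ k)
  set B : ℝ := 8 * k * 2 ^ k with hB
  have hB0 : 0 < B := by positivity
  set g : ℝ := (1 / (8 * B)) * Real.sqrt (1 / (8 * B)) with hg
  have hg0 : 0 < g := by positivity
  set e : ℝ := min (1 / (B * (3 * k))) (g / (12 * k * k * 2 ^ k)) with he
  have he0 : 0 < e := by
    rw [he, lt_min_iff]
    constructor <;> positivity
  have he1 : B * (3 * k * e) ≤ 1 := by
    have : e ≤ 1 / (B * (3 * k)) := min_le_left _ _
    rw [le_div_iff₀ (by positivity)] at this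
    linarith
  have he2 : k * (2 * (2 ^ k * (3 * k * e))) ≤ g / 2 := by
    have : e ≤ g / (12 * k * k * 2 ^ k) := min_le_right _ _
    rw [le_div_iff₀ (by positivity)] at this
    linarith
  set C : ℝ := k * (2 * (2 / e) + 2) + 2 * (2 / e + 2) with hC
  have hC0 : 0 < C := by positivity
  have hev : ∀ᶠ n : ℕ in atTop, 2 * C / g ≤ Real.sqrt n :=
    (Real.tendsto_sqrt_atTop.comp tendsto_natCast_atTop_atTop).eventually_ge_atTop _
  have hev2 : ∀ᶠ n : ℕ in atTop, 8 * B ≤ (n : ℝ) :=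
    tendsto_natCast_atTop_atTop.eventually_ge_atTop _
  filter_upwards [hev, hev2, eventually_ge_atTop 8] with n h1 h2 h3 S
  rcases S.core he0 h3 (by omega) he1 with ⟨c, hc⟩ | ⟨m, hm, hmain⟩
  · rw [← Finset.add_sum_erase _ _ (Finset.mem_univ c), hc]
    have : ∀ j ∈ Finset.univ.erase c, (pc (S.N j).Adj : ℝ) ≤ 2 * (ex4 n : ℝ) := by
      intro j _
      exact_mod_cast pc_le_ex (S.cf j)
    have := Finset.sum_le_sum this
    rw [Finset.sum_const, nsmul_eq_mul, Finset.card_erase_of_mem (Finset.mem_univ _)] at this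
    simp only [Finset.card_univ, Fintype.card_fin] at this
    rw [Nat.cast_sub (by omega)] at this
    push_cast at this ⊢
    linarith
  · have hm' : (n : ℝ) / B ≤ m := by
      rw [div_le_iff₀ hB0]
      linarith
    have hm8 : 8 ≤ m := by
      have : (8 : ℝ) ≤ m := by
        refine le_trans ?_ hm'
        rw [le_div_iff₀ hB0]
        exact h2
      exact_mod_cast this
    have hlow := ex_lower hm8
    have hn0 : (0 : ℝ) ≤ n := by positivity
    have hgap : g * (n * Real.sqrt n) ≤ 2 * (ex4 m : ℝ) := by
      refine le_trans ?_ hlow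
      have e1 : (n : ℝ) * (1 / (8 * B)) ≤ m / 8 := by
        have : (n : ℝ) * (1 / (8 * B)) = (n / B) / 8 := by field_simp
        rw [this]
        linarith
      have e2 : Real.sqrt n * Real.sqrt (1 / (8 * B)) ≤ Real.sqrt (m / 8) := by
        rw [← Real.sqrt_mul hn0]
        exact Real.sqrt_le_sqrt e1
      calc g * (n * Real.sqrt n) =
            ((n : ℝ) * (1 / (8 * B))) * (Real.sqrt n * Real.sqrt (1 / (8 * B))) := by
              rw [hg]; ring
        _ ≤ _ := by gcongr
    have hs : 0 ≤ Real.sqrt n := Real.sqrt_nonneg _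
    have hCs : C ≤ g / 2 * Real.sqrt n := by
      rw [div_le_iff₀ hg0] at h1
      linarith
    have hCn : C * n ≤ g / 2 * Real.sqrt n * n := by gcongr
    have hEn : k * (2 * (2 ^ k * (3 * k * e))) * (Real.sqrt n * n) ≤ g / 2 * (Real.sqrt n * n) := by
      gcongr
    have hid : (k * (2 * (2 * n / e) + 2 * (n + Real.sqrt n * (2 ^ k * (3 * k * e * n)))) +
          2 * (2 * n / e + 2 * n)) = C * n + k * (2 * (2 ^ k * (3 * k * e))) * (Real.sqrt n * n) := by
      rw [hC]; ring
    rw [hid] at hmain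
    linarith

/-- the setup attached to a colouring -/
def mkSetup {n k : ℕ} (c : Sym2 (Fin n) → Fin k) : Setup n k where
  col x y := c s(x, y)
  sym x y := by rw [Sym2.eq_swap]
  N i :=
    { Adj := fun x y => s(x, y) ∈ NIMedges (SimpleGraph.cycleGraph 4) c ∧ c s(x, y) = i
      symm := ⟨fun x y h => by rwa [Sym2.eq_swap]⟩
      loopless := ⟨fun x h => h.1.1 (by simp)⟩ }
  hN i u v h := h.2
  path := by
    intro i u v x y h hxu hyx hyv hxv hyu h1 h2 h3
    have huv : u ≠ v := fun e => h.1.1 (by simp [e])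
    refine h.1.2 i ![u, x, y, v] ?_ ?_ (u := 0) (v := 3) (by decide) rfl
    · intro a b hab
      fin_cases a <;> fin_cases b <;> simp at hab ⊢ <;> first | exact hab.elim | grind
    · intro a b hab
      rw [cyc4_adj] at hab
      have h4 := h.2
      have h1' : c s(x, u) = i := by rwa [Sym2.eq_swap]
      have h2' : c s(y, x) = i := by rwa [Sym2.eq_swap]
      have h3' : c s(v, y) = i := by rwa [Sym2.eq_swap]
      have h4' : c s(v, u) = i := by rwa [Sym2.eq_swap]
      fin_cases a <;> fin_cases b <;> simp at hab ⊢ <;> assumption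

lemma nim_pc {n k : ℕ} (c : Sym2 (Fin n) → Fin k) :
    2 * Nat.card (NIMedges (SimpleGraph.cycleGraph 4) c) =
      pc (fun x y => s(x, y) ∈ NIMedges (SimpleGraph.cycleGraph 4) c) := by
  let G : SimpleGraph (Fin n) :=
    { Adj := fun x y => s(x, y) ∈ NIMedges (SimpleGraph.cycleGraph 4) c
      symm := ⟨fun x y h => by rwa [Sym2.eq_swap]⟩
      loopless := ⟨fun x h => h.1 (by simp)⟩ }
  have h1 : G.edgeSet = NIMedges (SimpleGraph.cycleGraph 4) c := by
    ext e
    induction e with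
    | h x y => rw [SimpleGraph.mem_edgeSet]
  rw [← h1, ← pc_edges]
  simp only [h1]
  rfl

lemma f_bdd (n k : ℕ) : BddAbove {m | ∃ c : Sym2 (Fin n) → Fin k,
    m = Nat.card (NIMedges (SimpleGraph.cycleGraph 4) c)} := by
  refine ⟨Nat.card (Sym2 (Fin n)), ?_⟩
  rintro m ⟨c, rfl⟩
  exact Nat.card_le_card_of_injective _ Subtype.val_injective

lemma f_upper (k : ℕ) (hk : 2 ≤ k) : ∀ᶠ n : ℕ in atTop,
    (fNum n k (SimpleGraph.cycleGraph 4) : ℝ) ≤ (k - 1) * (ex4 n : ℝ) := by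
  filter_upwards [setup_upper k hk] with n h
  have hne : {m | ∃ c : Sym2 (Fin n) → Fin k,
    m = Nat.card (NIMedges (SimpleGraph.cycleGraph 4) c)}.Nonempty :=
    ⟨_, fun _ => ⟨0, by omega⟩, rfl⟩
  obtain ⟨c, hc⟩ := Nat.sSup_mem hne (f_bdd n k)
  have h1 := h (mkSetup c)
  have h2 : pc (fun x y => s(x, y) ∈ NIMedges (SimpleGraph.cycleGraph 4) c) ≤
      ∑ i, pc ((mkSetup c).N i).Adj := by
    apply pc_sum
    intro x y hxy
    exact ⟨c s(x, y), Finset.mem_univ _, hxy, rfl⟩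
  rw [← nim_pc] at h2
  have h3 : fNum n k (SimpleGraph.cycleGraph 4) =
    Nat.card (NIMedges (SimpleGraph.cycleGraph 4) c) := hc
  rw [← h3] at h2
  have h4 : 2 * (fNum n k (SimpleGraph.cycleGraph 4) : ℝ) ≤
    ∑ i, (pc ((mkSetup c).N i).Adj : ℝ) := by exact_mod_cast h2
  linarith

lemma two_trans {V : Type*} {x y x' y' : V} (h : x ≠ y) (h' : x' ≠ y') :
    ∃ t : Equiv.Perm V, t x = x' ∧ t y = y' := by
  classical
  set y1 := Equiv.swap x x' y with hy1
  have hne : y1 ≠ x' := by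
    intro e
    have : Equiv.swap x x' y = Equiv.swap x x' x := by rw [← hy1, e]; simp
    exact h ((Equiv.injective _ this).symm)
  refine ⟨(Equiv.swap x x').trans (Equiv.swap y1 y'), ?_, ?_⟩
  · simp only [Equiv.trans_apply, Equiv.swap_apply_left]
    exact Equiv.swap_apply_of_ne_of_ne hne.symm h'
  · simp only [Equiv.trans_apply]
    rw [← hy1]
    simp

lemma pc_perm {n : ℕ} (R : Fin n → Fin n → Prop) (s : Equiv.Perm (Fin n)) :
    pc (fun x y => R (s x) (s y)) = pc R := by
  classical
  unfold pc
  apply Finset.card_bij (fun p _ => (s p.1, s p.2))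
  · intro p hp
    simpa using hp
  · rintro ⟨a, b⟩ _ ⟨c, d⟩ _ h
    simpa using h
  · rintro ⟨a, b⟩ h
    exact ⟨(s.symm a, s.symm b), by simpa using h, by simp⟩

lemma avg {n : ℕ} (R : Fin n → Fin n → Prop) (hR : ∀ x, ¬ R x x) (G : SimpleGraph (Fin n)) :
    ∃ s : Equiv.Perm (Fin n),
      n * (n - 1) * pc (fun x y => R x y ∧ G.Adj (s x) (s y)) ≤ pc R * pc G.Adj := by
  classical
  by_contra hcon
  push Not at hcon
  set K : Fin n → Fin n → ℕ := fun x y =>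
    (Finset.univ.filter fun s : Equiv.Perm (Fin n) => G.Adj (s x) (s y)).card with hK
  have hKc : ∀ x y x' y', x ≠ y → x' ≠ y' → K x y = K x' y' := by
    intro x y x' y' h h'
    obtain ⟨t, rfl, rfl⟩ := two_trans h h'
    apply Finset.card_bij (fun s _ => t.symm.trans s)
    · intro s hs
      simpa using hs
    · intro s _ s' _ hss
      ext z
      have := congrArg (fun q => q (t z)) hss
      simpa using congrArg Fin.val this
    · intro s hs
      refine ⟨t.trans s, by simpa using hs, ?_⟩
      ext z
      simp
  have hswap : ∀ Q : Fin n → Fin n → Prop,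
      ∑ s : Equiv.Perm (Fin n), pc (fun x y => Q x y ∧ G.Adj (s x) (s y)) =
      ∑ p ∈ Finset.univ.filter (fun p : Fin n × Fin n => Q p.1 p.2), K p.1 p.2 := by
    intro Q
    have e1 : ∀ s : Equiv.Perm (Fin n), pc (fun x y => Q x y ∧ G.Adj (s x) (s y)) =
        ∑ p ∈ Finset.univ.filter (fun p : Fin n × Fin n => Q p.1 p.2),
          if G.Adj (s p.1) (s p.2) then 1 else 0 := by
      intro s
      rw [← Finset.card_filter, Finset.filter_filter]
      unfold pc
      congr!
    rw [Finset.sum_congr rfl (fun s _ => e1 s), Finset.sum_comm]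
    apply Finset.sum_congr rfl
    intro p _
    simp only [hK]
    rw [Finset.card_filter]
  have hall := hswap (fun x y => x ≠ y)
  have hall1 : ∑ s : Equiv.Perm (Fin n), pc (fun x y => x ≠ y ∧ G.Adj (s x) (s y)) =
      Fintype.card (Equiv.Perm (Fin n)) * pc G.Adj := by
    have : ∀ s : Equiv.Perm (Fin n), pc (fun x y => x ≠ y ∧ G.Adj (s x) (s y)) = pc G.Adj := by
      intro s
      rw [← pc_perm G.Adj s]
      congr 1
      ext x y
      constructor
      · exact fun h => h.2
      · exact fun h => ⟨fun e => h.ne (by rw [e]), h⟩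
    rw [Finset.sum_congr rfl (fun s _ => this s)]
    simp
  have hoff : (Finset.univ.filter (fun p : Fin n × Fin n => p.1 ≠ p.2)).card = n * (n - 1) := by
    have : Finset.univ.filter (fun p : Fin n × Fin n => p.1 ≠ p.2) =
      (Finset.univ : Finset (Fin n)).offDiag := by
      ext ⟨a, b⟩; simp
    rw [this, Finset.offDiag_card]
    simp [Nat.mul_sub]
  by_cases hne : ∃ p : Fin n × Fin n, R p.1 p.2
  · obtain ⟨p0, hp0⟩ := hne
    have hp0' : p0.1 ≠ p0.2 := fun e => hR p0.1 (by rw [← e] at hp0; exact hp0)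
    have h1 : n * (n - 1) * K p0.1 p0.2 = Fintype.card (Equiv.Perm (Fin n)) * pc G.Adj := by
      rw [← hall1, hall, ← hoff, ← smul_eq_mul, ← Finset.sum_const]
      apply Finset.sum_congr (by congr!)
      intro p hp
      simp only [Finset.mem_filter] at hp
      exact hKc _ _ _ _ hp0' hp.2
    have h2 := hswap R
    have h3 : ∑ p ∈ Finset.univ.filter (fun p : Fin n × Fin n => R p.1 p.2), K p.1 p.2 =
        pc R * K p0.1 p0.2 := by
      have : pc R = (Finset.univ.filter (fun p : Fin n × Fin n => R p.1 p.2)).card := by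
        unfold pc; congr!
      rw [this, ← smul_eq_mul, ← Finset.sum_const]
      apply Finset.sum_congr rfl
      intro p hp
      refine hKc _ _ _ _ ?_ hp0'
      intro e
      have := (Finset.mem_filter.1 hp).2
      rw [← e] at this
      exact hR _ this
    have h4 : ∑ s : Equiv.Perm (Fin n), pc R * pc G.Adj <
        ∑ s : Equiv.Perm (Fin n), n * (n - 1) * pc (fun x y => R x y ∧ G.Adj (s x) (s y)) :=
      Finset.sum_lt_sum_of_nonempty ⟨1, Finset.mem_univ _⟩ (fun s _ => hcon s)
    rw [← Finset.mul_sum _ _ (n * (n - 1)), h2, h3, Finset.sum_const, smul_eq_mul, Finset.card_univ] at h4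
    have : n * (n - 1) * (pc R * K p0.1 p0.2) =
      Fintype.card (Equiv.Perm (Fin n)) * (pc R * pc G.Adj) := by
      calc _ = pc R * (n * (n - 1) * K p0.1 p0.2) := by ring
        _ = _ := by rw [h1]; ring
    omega
  · push Not at hne
    have := hcon 1
    have h0 : pc (fun x y => R x y ∧ G.Adj ((1 : Equiv.Perm (Fin n)) x) ((1 : Equiv.Perm (Fin n)) y)) = 0 := by
      unfold pc
      rw [Finset.card_eq_zero, Finset.eq_empty_iff_forall_notMem]
      intro p h
      simp only [Finset.mem_filter] at h
      exact hne p h.2.1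
    rw [h0] at this
    omega

/-- packing nearly disjoint copies of an extremal graph -/
lemma packing (n : ℕ) (hn : 2 ≤ n) (j : ℕ) : ∃ F : ℕ → SimpleGraph (Fin n), (∀ i, CF (F i)) ∧
    (j : ℝ) * (2 * ex4 n) - j * j * ((2 * ex4 n) * (2 * ex4 n) / (n * (n - 1))) ≤
      (pc (fun x y => ∃ i < j, (F i).Adj x y) : ℝ) ∧
    (pc (fun x y => ∃ i < j, (F i).Adj x y) : ℝ) ≤ j * (2 * ex4 n) := by
  have hn1 : (0 : ℝ) < n * (n - 1) := by
    have : (2 : ℝ) ≤ n := by exact_mod_cast hn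
    nlinarith
  induction j with
  | zero =>
    refine ⟨fun _ => ⊥, fun i => ?_, ?_, ?_⟩
    · intro a b x y hab h1
      exact absurd h1 (by simp)
    · simp
    · simp [pc]
  | succ j ih =>
    obtain ⟨F, hF, h1, h2⟩ := ih
    obtain ⟨E, hE, hq⟩ := exists_ex n
    obtain ⟨s, hs⟩ := avg (fun x y => ∃ i < j, (F i).Adj x y)
      (by rintro x ⟨i, -, h⟩; exact h.ne rfl) E
    have hcf : CF (E.comap s) := by
      intro a b x y hab e1 e2 e3 e4
      exact s.injective (hE _ _ _ _ (fun e => hab (s.injective e)) e1 e2 e3 e4)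
    have hR : ∀ x y, (∃ i < j + 1, (Function.update F j (E.comap s) i).Adj x y) ↔
        ((∃ i < j, (F i).Adj x y) ∨ E.Adj (s x) (s y)) := by
      intro x y
      constructor
      · rintro ⟨i, hi, h⟩
        by_cases hij : i = j
        · subst hij
          rw [Function.update_self] at h
          exact Or.inr h
        · rw [Function.update_of_ne hij] at h
          exact Or.inl ⟨i, by omega, h⟩
      · rintro (⟨i, hi, h⟩ | h)
        · refine ⟨i, by omega, ?_⟩
          rwa [Function.update_of_ne (by omega)]
        · refine ⟨j, by omega, ?_⟩
          rw [Function.update_self]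
          exact h
    have hpcE : pc (fun x y => E.Adj (s x) (s y)) = 2 * ex4 n := by rw [pc_perm E.Adj s, hq]
    refine ⟨Function.update F j (E.comap s), ?_, ?_, ?_⟩
    · intro i
      by_cases hij : i = j
      · subst hij
        rw [Function.update_self]
        exact hcf
      · rw [Function.update_of_ne hij]
        exact hF i
    · simp only [hR]
      set R : Fin n → Fin n → Prop := fun x y => ∃ i < j, (F i).Adj x y with hRdef
      set I := pc (fun x y => R x y ∧ E.Adj (s x) (s y)) with hI
      have h5 : pc R + 2 * ex4 n ≤ pc (fun x y => R x y ∨ E.Adj (s x) (s y)) + I := by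
        have e1 : pc (fun x y => R x y ∨ (E.Adj (s x) (s y) ∧ ¬ R x y)) =
          pc R + pc (fun x y => E.Adj (s x) (s y) ∧ ¬ R x y) := by
          apply pc_or_disj
          intro x y h h'
          exact h'.2 h
        have e2 : pc (fun x y => R x y ∨ (E.Adj (s x) (s y) ∧ ¬ R x y)) ≤
            pc (fun x y => R x y ∨ E.Adj (s x) (s y)) := by
          apply pc_mono
          rintro x y (h | h)
          · exact Or.inl h
          · exact Or.inr h.1
        have e3 : pc (fun x y => E.Adj (s x) (s y)) ≤
            pc (fun x y => E.Adj (s x) (s y) ∧ ¬ R x y) + I := by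
          refine le_trans (pc_mono ?_) (pc_or _ _)
          intro x y h
          by_cases hr : R x y
          · exact Or.inr ⟨hr, h⟩
          · exact Or.inl ⟨h, hr⟩
        omega
      have h5' : (pc R : ℝ) + 2 * ex4 n ≤ (pc (fun x y => R x y ∨ E.Adj (s x) (s y)) : ℝ) + I := by
        exact_mod_cast h5
      have hI' : (I : ℝ) ≤ j * ((2 * ex4 n) * (2 * ex4 n) / (n * (n - 1))) := by
        rw [← mul_div_assoc, le_div_iff₀ hn1]
        have e1 : ((n * (n - 1) * I : ℕ) : ℝ) ≤ ((pc R * pc E.Adj : ℕ) : ℝ) := by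
          exact_mod_cast hs
        rw [hq] at e1
        push_cast [Nat.cast_sub (by omega : 1 ≤ n)] at e1
        have e2 : (pc R : ℝ) * (2 * ex4 n) ≤ (j * (2 * ex4 n)) * (2 * ex4 n) := by gcongr
        linarith
      push_cast
      have hpos : 0 ≤ (2 * (ex4 n : ℝ)) * (2 * ex4 n) / (n * (n - 1)) := by positivity
      have hj : (0 : ℝ) ≤ j := by positivity
      nlinarith [mul_nonneg hj hpos]
    · simp only [hR]
      have e := pc_or (fun x y => ∃ i < j, (F i).Adj x y) (fun x y => E.Adj (s x) (s y))
      rw [hpcE] at e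
      have e' : (pc (fun x y => (∃ i < j, (F i).Adj x y) ∨ E.Adj (s x) (s y)) : ℝ) ≤
        (pc (fun x y => ∃ i < j, (F i).Adj x y) : ℝ) + 2 * ex4 n := by exact_mod_cast e
      push_cast
      linarith

lemma f_ge {n k : ℕ} (hk : 2 ≤ k) (F : ℕ → SimpleGraph (Fin n)) (hF : ∀ i, CF (F i)) :
    pc (fun x y => ∃ i < k - 1, (F i).Adj x y) ≤ 2 * fNum n k (SimpleGraph.cycleGraph 4) := by
  classical
  let c : Sym2 (Fin n) → Fin k := fun e =>
    if h : ∃ i < k - 1, e ∈ (F i).edgeSet then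
      ⟨Nat.find h, by have := (Nat.find_spec h).1; omega⟩ else ⟨k - 1, by omega⟩
  have hc : ∀ e (i : ℕ), i < k - 1 → (c e : ℕ) = i → e ∈ (F i).edgeSet := by
    intro e i hi hci
    simp only [c] at hci
    split_ifs at hci with h
    · simp only at hci
      rw [← hci]
      exact (Nat.find_spec h).2
    · simp only at hci
      omega
  have hc2 : ∀ e, (∃ i < k - 1, e ∈ (F i).edgeSet) → (c e : ℕ) < k - 1 := by
    intro e h
    simp only [c, h, dif_pos]
    exact (Nat.find_spec h).1
  have h1 : Nat.card (NIMedges (SimpleGraph.cycleGraph 4) c) ≤ fNum n k (SimpleGraph.cycleGraph 4) :=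
    le_csSup (f_bdd n k) ⟨c, rfl⟩
  have h2 := nim_pc c
  have h3 : pc (fun x y => ∃ i < k - 1, (F i).Adj x y) ≤
      pc (fun x y => s(x, y) ∈ NIMedges (SimpleGraph.cycleGraph 4) c) := by
    apply pc_mono
    rintro x y ⟨i, hi, hxy⟩
    refine ⟨by simpa using hxy.ne, ?_⟩
    intro l f hf hl u v huv he
    have h4 : (c s(x, y) : ℕ) < k - 1 := hc2 _ ⟨i, hi, hxy⟩
    rw [he, hl huv] at h4
    refine (cf_iff (F l)).1 (hF l) ⟨f, hf, ?_⟩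
    intro a b hab
    exact hc _ _ h4 (congrArg Fin.val (hl hab))
  omega

lemma ex_ratio : Tendsto (fun n : ℕ => (ex4 n : ℝ) / (n * (n - 1))) atTop (nhds 0) := by
  have hb : ∀ᶠ n : ℕ in atTop, (ex4 n : ℝ) / (n * (n - 1)) ≤ 2 / Real.sqrt n := by
    filter_upwards [eventually_ge_atTop 2] with n hn
    have hn2 : (2 : ℝ) ≤ n := by exact_mod_cast hn
    obtain ⟨E, hE, hq⟩ := exists_ex n
    have h1 := kst hE Finset.univ
    simp only [Finset.mem_univ, true_and, Finset.card_univ, Fintype.card_fin] at h1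
    have h2 : (pc E.Adj : ℝ) = 2 * ex4 n := by exact_mod_cast hq
    have h1' : 2 * (ex4 n : ℝ) ≤ n + Real.sqrt n * n := by rw [← h2]; exact h1
    have hs : 1 ≤ Real.sqrt n := Real.one_le_sqrt.2 (by linarith)
    have hsq := Real.sq_sqrt (by linarith : (0 : ℝ) ≤ n)
    rw [div_le_div_iff₀ (by nlinarith) (by linarith)]
    have h3 : (ex4 n : ℝ) ≤ Real.sqrt n * n := by nlinarith
    have h4 : (ex4 n : ℝ) * Real.sqrt n ≤ Real.sqrt n * n * Real.sqrt n := by gcongr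
    nlinarith
  have hlim : Tendsto (fun n : ℕ => 2 / Real.sqrt (n : ℝ)) atTop (nhds 0) :=
    Tendsto.div_atTop tendsto_const_nhds
      (Real.tendsto_sqrt_atTop.comp tendsto_natCast_atTop_atTop)
  refine squeeze_zero' ?_ hb hlim
  filter_upwards [eventually_ge_atTop 2] with n hn
  have hn2 : (2 : ℝ) ≤ n := by exact_mod_cast hn
  have : (0 : ℝ) ≤ n - 1 := by linarith
  positivity

/-- Theorem 3.1: for every `k ≥ 2` and sufficiently large `n`,
`(k−1−o(1))·ex(n,C₄) ≤ f_k(n,C₄) ≤ (k−1)·ex(n,C₄)`. -/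
theorem stmt_11 (k : ℕ) (hk : 2 ≤ k) :
    ∃ ε : ℕ → ℝ, Tendsto ε atTop (nhds 0) ∧
      ∀ᶠ n in atTop,
        ((k : ℝ) - 1 - ε n) * (exNum n (SimpleGraph.cycleGraph 4) : ℝ) ≤
            (fNum n k (SimpleGraph.cycleGraph 4) : ℝ) ∧
          (fNum n k (SimpleGraph.cycleGraph 4) : ℝ) ≤
            ((k : ℝ) - 1) * (exNum n (SimpleGraph.cycleGraph 4) : ℝ) := by
  refine ⟨fun n => (2 * (k - 1) * (k - 1)) * ((ex4 n : ℝ) / (n * (n - 1))), ?_, ?_⟩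
  · simpa using ex_ratio.const_mul (2 * ((k : ℝ) - 1) * (k - 1))
  · filter_upwards [f_upper k hk, eventually_ge_atTop 2] with n h1 hn
    refine ⟨?_, h1⟩
    obtain ⟨F, hF, h2, -⟩ := packing n hn (k - 1)
    have h3 := f_ge hk F hF
    have h3' : (pc (fun x y => ∃ i < k - 1, (F i).Adj x y) : ℝ) ≤
      2 * (fNum n k (SimpleGraph.cycleGraph 4) : ℝ) := by exact_mod_cast h3
    rw [Nat.cast_sub (by omega)] at h2
    have h4 := h2.trans h3'
    push_cast at h4
    change _ * (ex4 n : ℝ) ≤ _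
    have e : (2 * (ex4 n : ℝ) * (2 * ex4 n) / (n * (n - 1))) =
      4 * (ex4 n * (ex4 n / (n * (n - 1)))) := by ring
    rw [e] at h4
    linarith
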